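/- Let u : ℝ² → ℝ be a Lipschitz function that is positively homogeneous of degree 1 (u(t·x) = t·u(x) for all t > 0 and x ∈ ℝ²), smooth on ℝ² \ {0}, satisfying the minimal surface equation on ℝ² \ {0}, and suppose u(x) ≤ 0 for all x ∈ ℝ². Then u is identically 0. Equivalently, a minimal cone in Euclidean ℝ³ that is a Lipschitz graph over ℝ² and is contained in the halfspace {z ≤ 0} is the horizontal plane {z = 0}. -/

import Mathlib

noncomputable section

/-- The partial derivative `∂ᵢ u` of a function `u : ℝ² → ℝ`. -/
noncomputable def pderiv2 (u : EuclideanSpace ℝ (Fin 2) → ℝ) (i : Fin 2)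
    (x : EuclideanSpace ℝ (Fin 2)) : ℝ :=
  fderiv ℝ u x (EuclideanSpace.single i 1)

/-- `u` satisfies the minimal surface equation on `U`: it is `C²` on `U` and
`(1 + (∂₂u)²)∂₁₁u − 2 ∂₁u ∂₂u ∂₁₂u + (1 + (∂₁u)²)∂₂₂u = 0` on `U`. -/
def MinimalSurfaceEquation (u : EuclideanSpace ℝ (Fin 2) → ℝ)
    (U : Set (EuclideanSpace ℝ (Fin 2))) : Prop :=
  ContDiffOn ℝ 2 u U ∧ ∀ x ∈ U,
    (1 + (pderiv2 u 1 x) ^ 2) * pderiv2 (pderiv2 u 0) 0 x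
      - 2 * pderiv2 u 0 x * pderiv2 u 1 x * pderiv2 (pderiv2 u 1) 0 x
      + (1 + (pderiv2 u 0 x) ^ 2) * pderiv2 (pderiv2 u 1) 1 x = 0

/-- Euler's relation for positively `1`-homogeneous functions. -/
theorem fderiv_apply_self_of_homogeneous {E : Type*} [NormedAddCommGroup E] [NormedSpace ℝ E]
    {u : E → ℝ} (hhom : ∀ t : ℝ, 0 < t → ∀ x, u (t • x) = t * u x) {x : E}
    (hx : DifferentiableAt ℝ u x) : fderiv ℝ u x x = u x := by
  have h1 : HasDerivAt (fun t : ℝ => t • x) x 1 := by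
    simpa using (hasDerivAt_id (1 : ℝ)).smul_const x
  have h2 : HasDerivAt (fun t : ℝ => u (t • x)) (fderiv ℝ u x x) 1 := by
    have hx' : HasFDerivAt u (fderiv ℝ u x) ((1 : ℝ) • x) := by
      simpa using hx.hasFDerivAt
    exact hx'.comp_hasDerivAt (1 : ℝ) h1
  have h3 : HasDerivAt (fun t : ℝ => t * u x) (u x) 1 := by
    simpa using (hasDerivAt_id (1 : ℝ)).mul_const (u x)
  refine h2.unique (h3.congr_of_eventuallyEq ?_)
  filter_upwards [lt_mem_nhds (zero_lt_one' ℝ)] with t ht using hhom t ht x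

/-- The Hessian of a function satisfying Euler's relation near `x` has `x` in its kernel. -/
theorem fderiv_fderiv_apply_self_eq_zero {E : Type*} [NormedAddCommGroup E] [NormedSpace ℝ E]
    {u : E → ℝ} {x : E} (heuler : ∀ᶠ y in nhds x, fderiv ℝ u y y = u y)
    (hu : DifferentiableAt ℝ u x) (hu' : DifferentiableAt ℝ (fderiv ℝ u) x) (v : E) :
    fderiv ℝ (fderiv ℝ u) x v x = 0 := by
  have h := hu'.hasFDerivAt.clm_apply (hasFDerivAt_id x)
  have h' := h.unique (hu.hasFDerivAt.congr_of_eventuallyEq heuler)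
  have := congrArg (fun L => L v) h'
  simpa using this

/-- A symmetric form `(a, b, c)` with a nonzero null vector `(x, y)` whose trace against the
coefficients of the minimal surface equation vanishes is zero. -/
theorem hessian_coeffs_eq_zero {a b c p q x y : ℝ} (hxy : x ≠ 0 ∨ y ≠ 0)
    (h0 : a * x + b * y = 0) (h1 : b * x + c * y = 0)
    (h : (1 + q ^ 2) * a - 2 * p * q * b + (1 + p ^ 2) * c = 0) :
    a = 0 ∧ b = 0 ∧ c = 0 := by
  have hpos : 0 < x ^ 2 + y ^ 2 + (p * x + q * y) ^ 2 := by
    rcases hxy with hx | hy <;> positivity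
  have ha : a = 0 := by
    have : a * (x ^ 2 + y ^ 2 + (p * x + q * y) ^ 2) = 0 := by
      linear_combination y ^ 2 * h - (1 + p ^ 2) * y * h1 + (1 + p ^ 2) * x * h0
        + 2 * p * q * y * h0
    exact (mul_eq_zero.1 this).resolve_right hpos.ne'
  have hc : c = 0 := by
    have : c * (x ^ 2 + y ^ 2 + (p * x + q * y) ^ 2) = 0 := by
      linear_combination x ^ 2 * h - (1 + q ^ 2) * x * h0 + (1 + q ^ 2) * y * h1
        + 2 * p * q * x * h1
    exact (mul_eq_zero.1 this).resolve_right hpos.ne'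
  subst ha hc
  refine ⟨rfl, ?_, rfl⟩
  rcases hxy with hx | hy
  · simpa [hx] using h1
  · simpa [hy] using h0

theorem pderiv2_pderiv2 {u : EuclideanSpace ℝ (Fin 2) → ℝ} {x : EuclideanSpace ℝ (Fin 2)}
    (hu : DifferentiableAt ℝ (fderiv ℝ u) x) (i j : Fin 2) :
    pderiv2 (pderiv2 u i) j x
      = fderiv ℝ (fderiv ℝ u) x (EuclideanSpace.single j 1) (EuclideanSpace.single i 1) := by
  have h := hu.hasFDerivAt.clm_apply (hasFDerivAt_const (EuclideanSpace.single i (1 : ℝ)) x)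
  have h' : fderiv ℝ (pderiv2 u i) x = _ := h.fderiv
  simp [pderiv2, h']

theorem euclideanSpace_two_eq_sum_single (v : EuclideanSpace ℝ (Fin 2)) :
    v = v 0 • EuclideanSpace.single 0 (1 : ℝ) + v 1 • EuclideanSpace.single 1 (1 : ℝ) := by
  ext i
  fin_cases i <;> simp

/-- A minimal cone in Euclidean `ℝ³` that is a Lipschitz graph over `ℝ²` and
lies in the halfspace `{z ≤ 0}` is the horizontal plane `{z = 0}`: a Lipschitz, positively
`1`-homogeneous, nonpositive function that is smooth and satisfies the minimal surface equation
away from the origin vanishes identically. -/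
theorem minimal_cone_lipschitz_graph_nonpositive_is_zero
    (u : EuclideanSpace ℝ (Fin 2) → ℝ) (K : NNReal) (hlip : LipschitzWith K u)
    (hhom : ∀ t : ℝ, 0 < t → ∀ x : EuclideanSpace ℝ (Fin 2), u (t • x) = t * u x)
    (hsmooth : ContDiffOn ℝ (⊤ : ℕ∞) u {(0 : EuclideanSpace ℝ (Fin 2))}ᶜ)
    (hmse : MinimalSurfaceEquation u {(0 : EuclideanSpace ℝ (Fin 2))}ᶜ)
    (hnonpos : ∀ x : EuclideanSpace ℝ (Fin 2), u x ≤ 0) :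
    ∀ x : EuclideanSpace ℝ (Fin 2), u x = 0 := by
  have hopen : IsOpen {(0 : EuclideanSpace ℝ (Fin 2))}ᶜ :=
    isOpen_compl_singleton
  have hC2 : ∀ x : EuclideanSpace ℝ (Fin 2), x ≠ 0 → ContDiffAt ℝ 2 u x := fun x hx =>
    hmse.1.contDiffAt (hopen.mem_nhds hx)
  have hdiff : ∀ x : EuclideanSpace ℝ (Fin 2), x ≠ 0 → DifferentiableAt ℝ u x := fun x hx =>
    (hC2 x hx).differentiableAt (by norm_num)
  have hdiff' : ∀ x : EuclideanSpace ℝ (Fin 2), x ≠ 0 → DifferentiableAt ℝ (fderiv ℝ u) x :=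
    fun x hx => ((hC2 x hx).fderiv_right (m := 1) (by norm_num)).differentiableAt (by norm_num)
  have heuler : ∀ x : EuclideanSpace ℝ (Fin 2), x ≠ 0 → fderiv ℝ u x x = u x := fun x hx =>
    fderiv_apply_self_of_homogeneous hhom (hdiff x hx)
  have hhess : ∀ x : EuclideanSpace ℝ (Fin 2), x ≠ 0 → fderiv ℝ (fderiv ℝ u) x = 0 := by
    intro x hx
    have hker := fderiv_fderiv_apply_self_eq_zero
      (Filter.eventually_of_mem (hopen.mem_nhds hx) heuler) (hdiff x hx) (hdiff' x hx)
    have hsymm : IsSymmSndFDerivAt ℝ u x := (hC2 x hx).isSymmSndFDerivAt (by simp)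
    have heq := hmse.2 x hx
    simp only [pderiv2_pderiv2 (hdiff' x hx)] at heq
    have hexp := euclideanSpace_two_eq_sum_single
    have hker' : ∀ v, fderiv ℝ (fderiv ℝ u) x v (EuclideanSpace.single 0 1) * x 0
        + fderiv ℝ (fderiv ℝ u) x v (EuclideanSpace.single 1 1) * x 1 = 0 := by
      intro v
      have h := hker v
      rw [congrArg (fderiv ℝ (fderiv ℝ u) x v) (hexp x)] at h
      simpa [mul_comm] using h
    have hs := hsymm.eq (EuclideanSpace.single 1 1) (EuclideanSpace.single 0 1)
    have h1 := hker' (EuclideanSpace.single 1 1)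
    rw [hs] at h1
    have hx' : x 0 ≠ 0 ∨ x 1 ≠ 0 := by
      by_contra! h
      exact hx (by rw [hexp x, h.1, h.2]; simp)
    obtain ⟨ha, hb, hc⟩ := hessian_coeffs_eq_zero hx' (hker' _) h1 heq
    ext v w
    rw [hexp v, hexp w]
    simp [ha, hb, hc, hs]
  have hconst : ∀ x : EuclideanSpace ℝ (Fin 2), x ≠ 0 → fderiv ℝ u (-x) = fderiv ℝ u x := by
    intro x hx
    have hconn : IsPreconnected {(0 : EuclideanSpace ℝ (Fin 2))}ᶜ :=
      (isConnected_compl_singleton_of_one_lt_rank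
        (by rw [← Module.finrank_eq_rank]; simp) 0).isPreconnected
    exact hopen.is_const_of_fderiv_eq_zero hconn
      (fun y hy => (hdiff' y hy).differentiableWithinAt) (fun y hy => hhess y hy)
      (neg_ne_zero.2 hx) hx
  intro x
  by_cases hx : x = 0
  · have h := hhom 2 two_pos 0
    rw [smul_zero] at h
    rw [hx]
    linarith
  · have h := heuler (-x) (neg_ne_zero.2 hx)
    rw [hconst x hx, map_neg, heuler x hx] at h
    linarith [hnonpos x, hnonpos (-x)]
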